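/- Let κ, λ be real numbers with 0 < κ ≤ 1/2 ≤ λ < 1 such that (κ,λ) satisfies the exponential-sum hypothesis for δ = 0 and for δ = 1. Let g be an arithmetic function with ∑_{n ≤ x} |g(n)| = O(x^{λ/(1+κ)}) for x ≥ 1, and let f be a positive real-valued arithmetic function with f(n) = ∑_{d|n} g(d) for all n, satisfying f(n) = O_ε(n^ε) for every ε > 0. Then for every ε > 0, S_f(x) = C_f · x + O_ε(x^{λ/(1+λ)+ε}) as x → ∞. -/

import Mathlib

open Finset Real Filter Asymptotics

/-- Additive character `e(θ) = e^{2πiθ}`. -/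
noncomputable def eChar (θ : ℝ) : ℂ := Complex.exp (2 * Real.pi * Complex.I * θ)

/-- The pair `(κ,λ)` with `0 < κ ≤ 1/2 ≤ λ < 1` satisfies the exponential-sum hypothesis
for `δ ≥ 0` with constant `A`: for all `T ≥ 1`, positive integers `m` and `X ≥ 1`,
`|∑_{X < n ≤ 2X} e(T/(mn+δ))| ≤ A ((T/(mX²))^κ X^λ + mX²/T)`. -/
def ExpSumHyp (δ κ lam A : ℝ) : Prop :=
  ∀ T : ℝ, 1 ≤ T → ∀ m : ℕ, 0 < m → ∀ X : ℝ, 1 ≤ X →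
    ‖∑ n ∈ Finset.Ioc ⌊X⌋₊ ⌊2 * X⌋₊, eChar (T / (m * n + δ))‖ ≤
      A * ((T / (m * X ^ 2)) ^ κ * X ^ lam + m * X ^ 2 / T)

/-- The sawtooth function `ψ(t) = {t} - 1/2`. -/
noncomputable def sawtooth (t : ℝ) : ℝ := Int.fract t - 1 / 2

/-- A periodic primitive of the sawtooth function. -/
noncomputable def sawtoothPrim (t : ℝ) : ℝ := (Int.fract t ^ 2 - Int.fract t) / 2 + 1 / 12

lemma abs_sawtooth_le (t : ℝ) : |sawtooth t| ≤ 1 := by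
  have h0 := Int.fract_nonneg t
  have h1 := Int.fract_lt_one t
  unfold sawtooth
  rw [abs_le]
  constructor <;> linarith

lemma sawtoothPrim_add_sub_le {u : ℝ} (hu0 : 0 ≤ u) (hu1 : u ≤ 1) (t : ℝ) :
    sawtoothPrim (t + u) - sawtoothPrim t ≤ u * sawtooth t + u ^ 2 / 2 := by
  have h0 := Int.fract_nonneg t
  have h1 := Int.fract_lt_one t
  have ht := Int.floor_add_fract t
  unfold sawtoothPrim sawtooth
  rcases lt_or_ge (Int.fract t + u) 1 with h | h
  · have : Int.fract (t + u) = Int.fract t + u := by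
      rw [Int.fract_eq_iff]
      exact ⟨by linarith, h, ⌊t⌋, by linarith⟩
    rw [this]
    nlinarith
  · have : Int.fract (t + u) = Int.fract t + u - 1 := by
      rw [Int.fract_eq_iff]
      exact ⟨by linarith, by linarith, ⌊t⌋ + 1, by push_cast; linarith⟩
    rw [this]
    nlinarith

lemma sawtoothPrim_sub_sub_le {u : ℝ} (hu0 : 0 ≤ u) (hu1 : u ≤ 1) (t : ℝ) :
    sawtoothPrim (t - u) - sawtoothPrim t ≤ -u * sawtooth t + u ^ 2 / 2 := by
  have h0 := Int.fract_nonneg t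
  have h1 := Int.fract_lt_one t
  have ht := Int.floor_add_fract t
  unfold sawtoothPrim sawtooth
  rcases lt_or_ge (Int.fract t - u) 0 with h | h
  · have : Int.fract (t - u) = Int.fract t - u + 1 := by
      rw [Int.fract_eq_iff]
      exact ⟨by linarith, by linarith, ⌊t⌋ - 1, by push_cast; linarith⟩
    rw [this]
    nlinarith
  · have : Int.fract (t - u) = Int.fract t - u := by
      rw [Int.fract_eq_iff]
      exact ⟨by linarith, by linarith, ⌊t⌋, by linarith⟩
    rw [this]
    nlinarith

lemma eval_bernoulli_two (x : ℝ) :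
    ((Polynomial.bernoulli 2).map (algebraMap ℚ ℝ)).eval x = x ^ 2 - x + 1 / 6 := by
  simp [Polynomial.bernoulli_def, Finset.sum_range_succ, bernoulli_two, bernoulli_one]
  ring

lemma hasSum_sawtoothPrim (t : ℝ) :
    HasSum (fun h : ℕ => 1 / (h : ℝ) ^ 2 * (eChar (h * t)).re) (2 * π ^ 2 * sawtoothPrim t) := by
  have hmem : Int.fract t ∈ Set.Icc (0 : ℝ) 1 :=
    ⟨Int.fract_nonneg t, (Int.fract_lt_one t).le⟩
  have h := hasSum_one_div_nat_pow_mul_cos one_ne_zero hmem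
  have hval : ((-1 : ℝ) ^ (1 + 1) * (2 * π) ^ (2 * 1) / 2 / ((2 * 1).factorial : ℝ) *
      ((Polynomial.bernoulli (2 * 1)).map (algebraMap ℚ ℝ)).eval (Int.fract t)) =
      2 * π ^ 2 * sawtoothPrim t := by
    rw [mul_one, eval_bernoulli_two]
    norm_num [sawtoothPrim, Nat.factorial]
    ring
  rw [hval] at h
  convert h using 2 with n
  have h1 : eChar (n * t) = Complex.exp ((2 * π * n * t : ℝ) * Complex.I) := by
    unfold eChar
    congr 1
    push_cast
    ring
  rw [h1, Complex.exp_ofReal_mul_I_re, mul_one]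
  congr 1
  have h2 : 2 * π * n * t = 2 * π * n * Int.fract t + ((n * ⌊t⌋ : ℤ) : ℝ) * (2 * π) := by
    rw [← Int.self_sub_floor t]
    push_cast
    ring
  rw [h2, Real.cos_add_int_mul_two_pi]

lemma eChar_add (s t : ℝ) : eChar (s + t) = eChar s * eChar t := by
  unfold eChar
  rw [← Complex.exp_add]
  congr 1
  push_cast
  ring

lemma norm_eChar (t : ℝ) : ‖eChar t‖ = 1 := by
  have : eChar t = Complex.exp ((2 * π * t : ℝ) * Complex.I) := by
    unfold eChar
    congr 1
    push_cast
    ring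
  rw [this, Complex.norm_exp_ofReal_mul_I]

lemma norm_eChar_sub_one_le_rpow (t : ℝ) {τ : ℝ} (h0 : 0 ≤ τ) (h1 : τ ≤ 1) :
    ‖eChar t - 1‖ ≤ 2 * π * |t| ^ τ := by
  rcases le_or_gt 1 |t| with ht | ht
  · have h2 : ‖eChar t - 1‖ ≤ 2 := by
      refine (norm_sub_le _ _).trans ?_
      rw [norm_eChar]
      norm_num
    have h3 : 1 ≤ |t| ^ τ := Real.one_le_rpow ht h0
    nlinarith [Real.pi_gt_three]
  · have h2 : eChar t = Complex.exp (Complex.I * (2 * π * t : ℝ)) := by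
      unfold eChar
      congr 1
      push_cast
      ring
    have h3 : ‖eChar t - 1‖ ≤ 2 * π * |t| := by
      rw [h2]
      refine Real.norm_exp_I_mul_ofReal_sub_one_le.trans ?_
      rw [Real.norm_eq_abs, abs_mul, abs_of_pos Real.two_pi_pos]
    refine h3.trans (mul_le_mul_of_nonneg_left ?_ Real.two_pi_pos.le)
    rcases (abs_nonneg t).eq_or_lt with h | h
    · rw [← h]
      exact Real.rpow_nonneg le_rfl _
    · simpa using Real.rpow_le_rpow_of_exponent_ge h ht.le h1

lemma abs_sum_sawtoothPrim_sub_le (S : Finset ℕ) (y : ℕ → ℝ) {a b κ η : ℝ}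
    (ha : 0 ≤ a) (hb : 0 ≤ b) (hκ : 0 ≤ κ) (hη : 0 < η) (hκη : κ + η ≤ 1)
    (hE : ∀ h : ℕ, 0 < h → ‖∑ n ∈ S, eChar (h * y n)‖ ≤ a * (h : ℝ) ^ κ + b / h) (v : ℝ) :
    |∑ n ∈ S, (sawtoothPrim (y n + v) - sawtoothPrim (y n))| ≤
      (∑' h : ℕ, 1 / (h : ℝ) ^ (1 + η)) * (a * |v| ^ (1 - κ - η) + b * |v|) := by
  have hs1 : HasSum (fun h : ℕ => ∑ n ∈ S, (1 / (h : ℝ) ^ 2 * (eChar (h * (y n + v))).re -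
      1 / (h : ℝ) ^ 2 * (eChar (h * y n)).re))
      (∑ n ∈ S, (2 * π ^ 2 * sawtoothPrim (y n + v) - 2 * π ^ 2 * sawtoothPrim (y n))) :=
    hasSum_sum fun n _ => (hasSum_sawtoothPrim _).sub (hasSum_sawtoothPrim _)
  have hsum : Summable fun h : ℕ => 1 / (h : ℝ) ^ (1 + η) :=
    Real.summable_one_div_nat_rpow.2 (by linarith)
  have hs2 := hsum.hasSum.mul_right (2 * π * (a * |v| ^ (1 - κ - η) + b * |v|))
  have hv := abs_nonneg v
  have key := hs1.norm_le_of_bounded hs2 ?_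
  · simp_rw [← mul_sub] at key
    rw [← Finset.mul_sum, norm_mul, Real.norm_eq_abs, Real.norm_eq_abs,
      abs_of_pos (by positivity)] at key
    have hZ : 0 ≤ ∑' h : ℕ, 1 / (h : ℝ) ^ (1 + η) := tsum_nonneg fun h => by positivity
    set Z := ∑' h : ℕ, 1 / (h : ℝ) ^ (1 + η)
    set W := a * |v| ^ (1 - κ - η) + b * |v|
    have hW : 0 ≤ W := by positivity
    have h3 : π * |∑ n ∈ S, (sawtoothPrim (y n + v) - sawtoothPrim (y n))| ≤ Z * W := by
      have : 0 < 2 * π := Real.two_pi_pos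
      refine le_of_mul_le_mul_left ?_ this
      calc _ = 2 * π ^ 2 * |∑ n ∈ S, (sawtoothPrim (y n + v) - sawtoothPrim (y n))| := by ring
        _ ≤ _ := key
        _ = _ := by ring
    nlinarith [Real.pi_gt_three,
      abs_nonneg (∑ n ∈ S, (sawtoothPrim (y n + v) - sawtoothPrim (y n)))]
  · intro h
    rcases Nat.eq_zero_or_pos h with rfl | hh
    · simp [Real.zero_rpow (show (1 + η) ≠ 0 by positivity)]
    have hh' : (1 : ℝ) ≤ h := by exact_mod_cast hh
    have hh0 : (0 : ℝ) < h := by positivity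
    have heq : ∑ n ∈ S, (1 / (h : ℝ) ^ 2 * (eChar (h * (y n + v))).re -
        1 / (h : ℝ) ^ 2 * (eChar (h * y n)).re) =
        1 / (h : ℝ) ^ 2 * ((eChar (h * v) - 1) * ∑ n ∈ S, eChar (h * y n)).re := by
      rw [Finset.mul_sum, Complex.re_sum, Finset.mul_sum]
      refine Finset.sum_congr rfl fun n _ => ?_
      rw [mul_add, eChar_add, sub_mul, one_mul, Complex.sub_re, mul_comm (eChar (h * v))]
      ring
    rw [heq, norm_mul, Real.norm_eq_abs, Real.norm_eq_abs, abs_of_pos (by positivity)]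
    have h1 : |((eChar (h * v) - 1) * ∑ n ∈ S, eChar (h * y n)).re| ≤
        ‖eChar (h * v) - 1‖ * (a * (h : ℝ) ^ κ + b / h) := by
      refine (Complex.abs_re_le_norm _).trans ?_
      rw [norm_mul]
      exact mul_le_mul_of_nonneg_left (hE h hh) (norm_nonneg _)
    have habs : |h * v| = h * |v| := by rw [abs_mul, abs_of_pos hh0]
    have h2 : ‖eChar (h * v) - 1‖ ≤ 2 * π * ((h : ℝ) ^ (1 - κ - η) * |v| ^ (1 - κ - η)) := by
      have := norm_eChar_sub_one_le_rpow (h * v) (τ := 1 - κ - η) (by linarith) (by linarith)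
      rwa [habs, Real.mul_rpow hh0.le hv] at this
    have h3 : ‖eChar (h * v) - 1‖ ≤ 2 * π * (h * |v|) := by
      have := norm_eChar_sub_one_le_rpow (h * v) (τ := 1) (by linarith) (by linarith)
      rwa [habs, Real.rpow_one] at this
    have e1 : (h : ℝ) ^ (1 - κ - η) * (h : ℝ) ^ κ = (h : ℝ) ^ 2 * (1 / (h : ℝ) ^ (1 + η)) := by
      rw [← Real.rpow_add hh0, one_div, ← Real.rpow_neg hh0.le, ← Real.rpow_natCast,
        ← Real.rpow_add hh0]
      congr 1
      push_cast
      ring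
    have e2 : 1 ≤ (h : ℝ) ^ 2 * (1 / (h : ℝ) ^ (1 + η)) := by
      rw [← e1, ← Real.rpow_add hh0]
      exact Real.one_le_rpow hh' (by linarith)
    calc 1 / (h : ℝ) ^ 2 * |((eChar (h * v) - 1) * ∑ n ∈ S, eChar (h * y n)).re|
        ≤ 1 / (h : ℝ) ^ 2 * (‖eChar (h * v) - 1‖ * (a * (h : ℝ) ^ κ + b / h)) := by gcongr
      _ = 1 / (h : ℝ) ^ 2 * (‖eChar (h * v) - 1‖ * (a * (h : ℝ) ^ κ) +
            ‖eChar (h * v) - 1‖ * (b / h)) := by ring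
      _ ≤ 1 / (h : ℝ) ^ 2 *
            (2 * π * ((h : ℝ) ^ (1 - κ - η) * |v| ^ (1 - κ - η)) * (a * (h : ℝ) ^ κ) +
              2 * π * (h * |v|) * (b / h)) := by gcongr
      _ = 1 / (h : ℝ) ^ 2 * (2 * π * a * |v| ^ (1 - κ - η) *
            ((h : ℝ) ^ (1 - κ - η) * (h : ℝ) ^ κ) + 2 * π * b * |v|) := by
          field_simp
      _ ≤ 1 / (h : ℝ) ^ 2 * (2 * π * a * |v| ^ (1 - κ - η) *
            ((h : ℝ) ^ 2 * (1 / (h : ℝ) ^ (1 + η))) +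
            2 * π * b * |v| * ((h : ℝ) ^ 2 * (1 / (h : ℝ) ^ (1 + η)))) := by
          rw [e1]
          exact mul_le_mul_of_nonneg_left
            (add_le_add le_rfl (le_mul_of_one_le_right (by positivity) e2)) (by positivity)
      _ = 1 / (h : ℝ) ^ (1 + η) * (2 * π * (a * |v| ^ (1 - κ - η) + b * |v|)) := by
          field_simp

/-- A bound for sawtooth sums in terms of exponential sums. -/
lemma abs_sum_sawtooth_le (S : Finset ℕ) (y : ℕ → ℝ) {a b κ η u : ℝ}
    (ha : 0 ≤ a) (hb : 0 ≤ b) (hκ : 0 ≤ κ) (hη : 0 < η) (hκη : κ + η ≤ 1)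
    (hu : 0 < u) (hu1 : u ≤ 1)
    (hE : ∀ h : ℕ, 0 < h → ‖∑ n ∈ S, eChar (h * y n)‖ ≤ a * (h : ℝ) ^ κ + b / h) :
    |∑ n ∈ S, sawtooth (y n)| ≤ S.card * u +
      (∑' h : ℕ, 1 / (h : ℝ) ^ (1 + η)) * (a * u ^ (-κ - η) + b) := by
  have h1 := abs_sum_sawtoothPrim_sub_le S y ha hb hκ hη hκη hE u
  have h2 := abs_sum_sawtoothPrim_sub_le S y ha hb hκ hη hκη hE (-u)
  rw [abs_neg] at h2
  rw [abs_of_pos hu] at h1 h2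
  have e : u ^ (1 - κ - η) = u * u ^ (-κ - η) := by
    rw [show 1 - κ - η = 1 + (-κ - η) by ring, Real.rpow_add hu, Real.rpow_one]
  rw [e] at h1 h2
  set Z := ∑' h : ℕ, 1 / (h : ℝ) ^ (1 + η)
  have h3 : ∑ n ∈ S, (sawtoothPrim (y n + u) - sawtoothPrim (y n)) ≤
      u * ∑ n ∈ S, sawtooth (y n) + S.card * (u ^ 2 / 2) := by
    rw [Finset.mul_sum, ← nsmul_eq_mul, ← Finset.sum_const, ← Finset.sum_add_distrib]
    exact Finset.sum_le_sum fun n _ => sawtoothPrim_add_sub_le hu.le hu1 _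
  have h4 : ∑ n ∈ S, (sawtoothPrim (y n + -u) - sawtoothPrim (y n)) ≤
      -u * ∑ n ∈ S, sawtooth (y n) + S.card * (u ^ 2 / 2) := by
    rw [Finset.mul_sum, ← nsmul_eq_mul, ← Finset.sum_const, ← Finset.sum_add_distrib]
    exact Finset.sum_le_sum fun n _ => sawtoothPrim_sub_sub_le hu.le hu1 _
  rw [abs_le] at h1 h2
  have hc : 0 ≤ (S.card : ℝ) * u ^ 2 := by positivity
  rw [abs_le]
  constructor <;> refine le_of_mul_le_mul_left ?_ hu <;> nlinarith

/-- The main term in the bound for `∑_{D/m < n ≤ 2D/m} ψ(x/(mn+δ))`. -/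
noncomputable def blockTerm (κ lam x D m : ℝ) : ℝ :=
  x ^ (κ / (1 + κ)) * D ^ ((lam - κ) / (1 + κ)) * m ^ (-(lam / (1 + κ)))

lemma blockTerm_pos {κ lam x D m : ℝ} (hx : 0 < x) (hD : 0 < D) (hm : 0 < m) :
    0 < blockTerm κ lam x D m := by
  unfold blockTerm
  positivity

lemma card_Ioc_floor_le {X : ℝ} (hX : 1 ≤ X) :
    ((Finset.Ioc ⌊X⌋₊ ⌊2 * X⌋₊).card : ℝ) ≤ 2 * X := by
  have h0 : ⌊2 * X⌋₊ - ⌊X⌋₊ ≤ ⌊2 * X⌋₊ := Nat.sub_le _ _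
  rw [Nat.card_Ioc]
  exact (Nat.cast_le.2 h0).trans (Nat.floor_le (by linarith))

lemma abs_sum_sawtooth_le_card (S : Finset ℕ) (y : ℕ → ℝ) :
    |∑ n ∈ S, sawtooth (y n)| ≤ S.card := by
  refine (Finset.abs_sum_le_sum_abs _ _).trans ?_
  refine (Finset.sum_le_sum fun n _ => abs_sawtooth_le (y n)).trans ?_
  simp

lemma half_le_blockTerm {κ lam x D m : ℝ} (hκ₀ : 0 < κ) (hlam : 0 ≤ lam) (hlam₁ : lam < 1)
    (hD : 0 < D) (hDx : D ≤ x) (hm : 0 < m) (hmD : m ≤ 2 * D) :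
    1 / 2 ≤ blockTerm κ lam x D m := by
  have hs0 : 0 ≤ lam / (1 + κ) := by positivity
  have hs1 : lam / (1 + κ) ≤ 1 := by
    rw [div_le_one (by linarith)]
    linarith
  have h1 : D ^ (κ / (1 + κ)) ≤ x ^ (κ / (1 + κ)) :=
    Real.rpow_le_rpow hD.le hDx (by positivity)
  have h2 : (2 * D) ^ (-(lam / (1 + κ))) ≤ m ^ (-(lam / (1 + κ))) :=
    Real.rpow_le_rpow_of_nonpos hm hmD (by linarith)
  have h3 : D ^ (κ / (1 + κ)) * D ^ ((lam - κ) / (1 + κ)) * (2 * D) ^ (-(lam / (1 + κ))) =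
      2 ^ (-(lam / (1 + κ))) := by
    rw [Real.mul_rpow two_pos.le hD.le, ← Real.rpow_add hD, mul_left_comm, ← Real.rpow_add hD]
    have : κ / (1 + κ) + (lam - κ) / (1 + κ) + -(lam / (1 + κ)) = 0 := by ring
    rw [this, Real.rpow_zero, mul_one]
  have h4 : (1 / 2 : ℝ) ≤ 2 ^ (-(lam / (1 + κ))) := by
    calc (1 / 2 : ℝ) = 2 ^ (-1 : ℝ) := by rw [Real.rpow_neg_one]; norm_num
      _ ≤ _ := Real.rpow_le_rpow_of_exponent_le (by norm_num) (by linarith)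
  rw [← h3] at h4
  refine h4.trans ?_
  have hx := hD.trans_le hDx
  unfold blockTerm
  gcongr

lemma one_le_blockTerm {κ lam x D m : ℝ} (hκ₀ : 0 < κ) (hκlam : κ ≤ lam)
    (hDx : D ≤ x) (hm : 0 < m) (hmD : m ≤ D) : 1 ≤ blockTerm κ lam x D m := by
  have h1 : m ^ (κ / (1 + κ)) ≤ x ^ (κ / (1 + κ)) :=
    Real.rpow_le_rpow hm.le (hmD.trans hDx) (by positivity)
  have h2 : m ^ ((lam - κ) / (1 + κ)) ≤ D ^ ((lam - κ) / (1 + κ)) :=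
    Real.rpow_le_rpow hm.le hmD (div_nonneg (by linarith) (by linarith))
  have h3 : m ^ (κ / (1 + κ)) * m ^ ((lam - κ) / (1 + κ)) * m ^ (-(lam / (1 + κ))) = 1 := by
    rw [← Real.rpow_add hm, ← Real.rpow_add hm]
    have : κ / (1 + κ) + (lam - κ) / (1 + κ) + -(lam / (1 + κ)) = 0 := by ring
    rw [this, Real.rpow_zero]
  rw [← h3]
  unfold blockTerm
  have hD := hm.trans_le hmD
  have hx := hD.trans_le hDx
  gcongr

lemma expSum_main_term_eq {κ lam x D m : ℝ} (hκ₀ : 0 < κ) (hx : 0 < x) (hD : 0 < D)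
    (hm : 0 < m) :
    (x / (m * (D / m) ^ 2)) ^ κ * (D / m) ^ lam =
      D / m * (blockTerm κ lam x D m / (D / m)) ^ (1 + κ) := by
  have hX : 0 < D / m := by positivity
  have hV : 0 < blockTerm κ lam x D m := blockTerm_pos hx hD hm
  have hk : 1 + κ ≠ 0 := by positivity
  refine Real.log_injOn_pos (Set.mem_Ioi.2 (by positivity)) (Set.mem_Ioi.2 (by positivity)) ?_
  rw [Real.log_mul (by positivity) (by positivity), Real.log_mul (by positivity) (by positivity),
    Real.log_rpow (by positivity), Real.log_rpow (by positivity), Real.log_rpow (by positivity),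
    Real.log_div hV.ne' hX.ne', Real.log_div hx.ne' (by positivity),
    Real.log_mul hm.ne' (by positivity), Real.log_pow, Real.log_div hD.ne' hm.ne']
  unfold blockTerm
  rw [Real.log_mul (by positivity) (by positivity), Real.log_mul (by positivity) (by positivity),
    Real.log_rpow hx, Real.log_rpow hD, Real.log_rpow hm]
  push_cast
  field_simp
  ring

lemma exists_sawtooth_block_bound {δ κ lam A η : ℝ} (hκ₀ : 0 < κ) (hκlam : κ ≤ lam)
    (hlam₁ : lam < 1) (hA : ExpSumHyp δ κ lam A) (hη : 0 < η) (hκη : κ + η ≤ 1) :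
    ∃ C : ℝ, 0 < C ∧ ∀ x D : ℝ, 1 ≤ x → 0 < D → D ≤ x → ∀ m : ℕ, 0 < m → (m : ℝ) ≤ 2 * D →
      |∑ n ∈ Finset.Ioc ⌊D / m⌋₊ ⌊2 * (D / m)⌋₊, sawtooth (x / (m * n + δ))| ≤
        C * (x ^ η * blockTerm κ lam x D m + D ^ 2 / (m * x)) := by
  have hZ : 0 ≤ ∑' h : ℕ, 1 / (h : ℝ) ^ (1 + η) := tsum_nonneg fun h => by positivity
  set Z := ∑' h : ℕ, 1 / (h : ℝ) ^ (1 + η) with hZdef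
  refine ⟨2 + Z * |A|, by positivity, fun x D hx hD hDx m hm hmD => ?_⟩
  have hx0 : 0 < x := by linarith
  have hm0 : (0 : ℝ) < m := by exact_mod_cast hm
  have hxη : 1 ≤ x ^ η := Real.one_le_rpow hx hη.le
  have hVpos := blockTerm_pos (κ := κ) (lam := lam) hx0 hD hm0
  have hV := half_le_blockTerm hκ₀ (hκ₀.le.trans hκlam) hlam₁ hD hDx hm0 hmD
  set V := blockTerm κ lam x D m with hVdef
  have hX0 : 0 < D / m := by positivity
  have hVx : V ≤ x ^ η * V := le_mul_of_one_le_left hVpos.le hxη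
  have hR : 0 ≤ D ^ 2 / (m * x) := by positivity
  have htriv : ((Finset.Ioc ⌊D / m⌋₊ ⌊2 * (D / m)⌋₊).card : ℝ) ≤ 2 * V →
      |∑ n ∈ Finset.Ioc ⌊D / m⌋₊ ⌊2 * (D / m)⌋₊, sawtooth (x / (m * n + δ))| ≤
        (2 + Z * |A|) * (x ^ η * V + D ^ 2 / (m * x)) := by
    intro h
    refine (abs_sum_sawtooth_le_card _ _).trans (h.trans ?_)
    have : 0 ≤ Z * |A| * (x ^ η * V + D ^ 2 / (m * x)) := by positivity
    linarith
  rcases lt_or_ge (D / m) 1 with hX | hX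
  · refine htriv ?_
    have h1 : ⌊2 * (D / m)⌋₊ ≤ 1 := by
      rw [← Nat.lt_succ_iff, Nat.floor_lt (by positivity)]
      push_cast
      linarith
    have h2 : (Finset.Ioc ⌊D / m⌋₊ ⌊2 * (D / m)⌋₊).card ≤ 1 := by
      rw [Nat.card_Ioc]
      omega
    have h3 : ((Finset.Ioc ⌊D / m⌋₊ ⌊2 * (D / m)⌋₊).card : ℝ) ≤ 1 := by exact_mod_cast h2
    linarith
  have hcard := card_Ioc_floor_le hX
  rcases le_or_gt (D / m) V with hXV | hXV
  · exact htriv (by linarith)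
  have hmD' : (m : ℝ) ≤ D := by rwa [one_le_div hm0] at hX
  have hV1 : 1 ≤ V := one_le_blockTerm hκ₀ hκlam hDx hm0 hmD'
  set u := V / (D / m) with hu
  have hu0 : 0 < u := by positivity
  have hu1 : u ≤ 1 := by
    rw [hu, div_le_one hX0]
    exact hXV.le
  have hXx : D / m ≤ x := (div_le_self hD.le (by exact_mod_cast hm)).trans hDx
  have hux : x⁻¹ ≤ u := by
    rw [hu, ← one_div]
    exact div_le_div₀ hVpos.le hV1 hX0 hXx
  have hE : ∀ h : ℕ, 0 < h →
      ‖∑ n ∈ Finset.Ioc ⌊D / m⌋₊ ⌊2 * (D / m)⌋₊, eChar (h * (x / (m * n + δ)))‖ ≤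
        (|A| * (D / m * u ^ (1 + κ))) * (h : ℝ) ^ κ + (|A| * (D ^ 2 / (m * x))) / h := by
    intro h hh
    have hh1 : (1 : ℝ) ≤ h := by exact_mod_cast hh
    have hh0 : (0 : ℝ) < h := by linarith
    have := hA (h * x) (one_le_mul_of_one_le_of_one_le hh1 hx) m hm (D / m) hX
    simp_rw [mul_div_assoc] at this ⊢
    refine this.trans ?_
    rw [Real.mul_rpow hh0.le (by positivity), mul_assoc ((h : ℝ) ^ κ),
      expSum_main_term_eq hκ₀ hx0 hD hm0, ← hVdef, ← hu]
    have e : (m : ℝ) * ((D / m) ^ 2 / (h * x)) = D ^ 2 / (m * x) / h := by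
      field_simp
    rw [e]
    calc A * ((h : ℝ) ^ κ * (D / m * u ^ (1 + κ)) + D ^ 2 / (m * x) / h)
        ≤ |A| * ((h : ℝ) ^ κ * (D / m * u ^ (1 + κ)) + D ^ 2 / (m * x) / h) := by
          gcongr
          exact le_abs_self A
      _ = _ := by ring
  have key := abs_sum_sawtooth_le _ _ (by positivity) (by positivity) hκ₀.le hη hκη hu0 hu1 hE
  rw [← hZdef] at key
  refine key.trans ?_
  have hXu : D / m * u = V := by
    rw [hu]
    field_simp
  have huη : u ^ (-η) ≤ x ^ η := by
    calc u ^ (-η) ≤ x⁻¹ ^ (-η) :=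
          Real.rpow_le_rpow_of_nonpos (by positivity) hux (by linarith)
      _ = x ^ η := by rw [Real.inv_rpow hx0.le, Real.rpow_neg hx0.le, inv_inv]
  have h1 : D / m * u ^ (1 + κ) * u ^ (-κ - η) = V * u ^ (-η) := by
    rw [mul_assoc, ← Real.rpow_add hu0, show 1 + κ + (-κ - η) = 1 + -η by ring,
      Real.rpow_add hu0, Real.rpow_one, ← mul_assoc, hXu]
  have h2 : ((Finset.Ioc ⌊D / m⌋₊ ⌊2 * (D / m)⌋₊).card : ℝ) * u ≤ 2 * V := by
    rw [← hXu, ← mul_assoc]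
    gcongr
  calc ((Finset.Ioc ⌊D / m⌋₊ ⌊2 * (D / m)⌋₊).card : ℝ) * u +
        Z * (|A| * (D / m * u ^ (1 + κ)) * u ^ (-κ - η) + |A| * (D ^ 2 / (m * x)))
      = ((Finset.Ioc ⌊D / m⌋₊ ⌊2 * (D / m)⌋₊).card : ℝ) * u +
        Z * |A| * (V * u ^ (-η) + D ^ 2 / (m * x)) := by rw [← h1]; ring
    _ ≤ 2 * V + Z * |A| * (V * x ^ η + D ^ 2 / (m * x)) := by gcongr
    _ ≤ (2 + Z * |A|) * (x ^ η * V + D ^ 2 / (m * x)) := by nlinarith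

lemma abs_sum_Icc_le_of_dyadic (F : ℕ → ℝ) {B y₀ : ℝ}
    (hB : ∀ D : ℝ, 0 < D → 2 * D ≤ y₀ → |∑ n ∈ Finset.Ioc ⌊D⌋₊ ⌊2 * D⌋₊, F n| ≤ B) (J : ℕ) :
    ∀ Y : ℝ, 0 < Y → Y ≤ y₀ → Y < 2 ^ J → |∑ n ∈ Finset.Icc 1 ⌊Y⌋₊, F n| ≤ J * B := by
  induction J with
  | zero =>
    intro Y hY0 _ hY
    have : ⌊Y⌋₊ = 0 := Nat.floor_eq_zero.2 (by simpa using hY)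
    simp [this]
  | succ J ih =>
    intro Y hY0 hYy hY
    have h1 := ih (Y / 2) (by linarith) (by linarith) (by rw [pow_succ] at hY; linarith)
    have h2 := hB (Y / 2) (by linarith) (by linarith)
    rw [mul_div_cancel₀ Y two_ne_zero] at h2
    have hle : ⌊Y / 2⌋₊ ≤ ⌊Y⌋₊ := Nat.floor_le_floor (by linarith)
    have e : ∑ n ∈ Finset.Icc 1 ⌊Y⌋₊, F n =
        ∑ n ∈ Finset.Icc 1 ⌊Y / 2⌋₊, F n + ∑ n ∈ Finset.Ioc ⌊Y / 2⌋₊ ⌊Y⌋₊, F n := by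
      rw [← Finset.sum_union]
      · congr 1
        ext n
        simp only [Finset.mem_union, Finset.mem_Icc, Finset.mem_Ioc]
        omega
      · rw [Finset.disjoint_left]
        intro n
        simp only [Finset.mem_Icc, Finset.mem_Ioc]
        omega
    rw [e]
    refine (abs_add_le _ _).trans ?_
    push_cast
    linarith

lemma sum_abs_mul_rpow_neg_le {g : ℕ → ℝ} {Cg s : ℝ} (hCg : 0 ≤ Cg) (hs : 0 ≤ s)
    (hg : ∀ x : ℝ, 1 ≤ x → ∑ n ∈ Finset.Icc 1 ⌊x⌋₊, |g n| ≤ Cg * x ^ s)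
    (J : ℕ) {Y : ℝ} (hY0 : 0 < Y) (hY : Y < 2 ^ J) :
    ∑ m ∈ Finset.Icc 1 ⌊Y⌋₊, |g m| * (m : ℝ) ^ (-s) ≤ J * (Cg * 2 ^ s) := by
  refine (le_abs_self _).trans
    (abs_sum_Icc_le_of_dyadic (fun m => |g m| * (m : ℝ) ^ (-s)) (y₀ := Y) ?_ J Y hY0 le_rfl hY)
  intro D hD _
  rw [abs_of_nonneg (Finset.sum_nonneg fun i _ => by positivity)]
  rcases lt_or_ge (2 * D) 1 with h | h
  · have : ⌊2 * D⌋₊ = 0 := Nat.floor_eq_zero.2 h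
    simp only [this, Finset.Ioc_eq_empty_of_le (Nat.zero_le _), Finset.sum_empty]
    positivity
  calc ∑ m ∈ Finset.Ioc ⌊D⌋₊ ⌊2 * D⌋₊, |g m| * (m : ℝ) ^ (-s)
      ≤ ∑ m ∈ Finset.Ioc ⌊D⌋₊ ⌊2 * D⌋₊, |g m| * D ^ (-s) := by
        refine Finset.sum_le_sum fun m hm => ?_
        have hDm : D < m := (Nat.floor_lt hD.le).1 (Finset.mem_Ioc.1 hm).1
        exact mul_le_mul_of_nonneg_left
          (Real.rpow_le_rpow_of_nonpos hD hDm.le (by linarith)) (abs_nonneg _)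
    _ = (∑ m ∈ Finset.Ioc ⌊D⌋₊ ⌊2 * D⌋₊, |g m|) * D ^ (-s) := by rw [Finset.sum_mul]
    _ ≤ (∑ m ∈ Finset.Icc 1 ⌊2 * D⌋₊, |g m|) * D ^ (-s) := by
        refine mul_le_mul_of_nonneg_right ?_ (by positivity)
        refine Finset.sum_le_sum_of_subset_of_nonneg (fun m => ?_) fun _ _ _ => abs_nonneg _
        simp only [Finset.mem_Icc, Finset.mem_Ioc]
        omega
    _ ≤ Cg * (2 * D) ^ s * D ^ (-s) := mul_le_mul_of_nonneg_right (hg _ h) (by positivity)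
    _ = Cg * 2 ^ s := by
        rw [Real.mul_rpow two_pos.le hD.le, Real.rpow_neg hD.le]
        have : D ^ s ≠ 0 := by positivity
        field_simp

lemma sum_Ioc_filter_dvd {D : ℝ} (hD : 0 ≤ D) {m : ℕ} (hm : 0 < m) (F : ℕ → ℝ) :
    ∑ d ∈ Finset.Ioc ⌊D⌋₊ ⌊2 * D⌋₊ with m ∣ d, F d =
      ∑ n ∈ Finset.Ioc ⌊D / m⌋₊ ⌊2 * (D / m)⌋₊, F (m * n) := by
  have hm0 : (0 : ℝ) < m := by exact_mod_cast hm
  have hmem : ∀ n : ℕ, m * n ∈ Finset.Ioc ⌊D⌋₊ ⌊2 * D⌋₊ ↔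
      n ∈ Finset.Ioc ⌊D / m⌋₊ ⌊2 * (D / m)⌋₊ := by
    intro n
    rw [Finset.mem_Ioc, Finset.mem_Ioc, Nat.floor_lt hD, Nat.floor_lt (by positivity),
      Nat.le_floor_iff (by positivity), Nat.le_floor_iff (by positivity), div_lt_iff₀ hm0,
      ← mul_div_assoc, le_div_iff₀ hm0]
    push_cast
    rw [mul_comm (n : ℝ)]
  symm
  refine Finset.sum_bij' (fun n _ => m * n) (fun d _ => d / m) ?_ ?_ ?_ ?_ ?_
  · intro n hn
    exact Finset.mem_filter.2 ⟨(hmem n).2 hn, dvd_mul_right _ _⟩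
  · intro d hd
    obtain ⟨h1, n, rfl⟩ := Finset.mem_filter.1 hd
    rw [Nat.mul_div_cancel_left _ hm]
    exact (hmem n).1 h1
  · intro n _
    exact Nat.mul_div_cancel_left _ hm
  · intro d hd
    exact Nat.mul_div_cancel' (Finset.mem_filter.1 hd).2
  · intro n _
    rfl

lemma sum_Ioc_divisor_sum_mul {f g : ℕ → ℝ}
    (hfg : ∀ n : ℕ, 0 < n → f n = ∑ d ∈ n.divisors, g d) {D : ℝ} (hD : 0 ≤ D) (F : ℕ → ℝ) :
    ∑ d ∈ Finset.Ioc ⌊D⌋₊ ⌊2 * D⌋₊, f d * F d =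
      ∑ m ∈ Finset.Icc 1 ⌊2 * D⌋₊,
        g m * ∑ n ∈ Finset.Ioc ⌊D / m⌋₊ ⌊2 * (D / m)⌋₊, F (m * n) := by
  calc ∑ d ∈ Finset.Ioc ⌊D⌋₊ ⌊2 * D⌋₊, f d * F d
      = ∑ d ∈ Finset.Ioc ⌊D⌋₊ ⌊2 * D⌋₊, ∑ m ∈ d.divisors, g m * F d := by
        refine Finset.sum_congr rfl fun d hd => ?_
        rw [hfg d (by have := (Finset.mem_Ioc.1 hd).1; omega), Finset.sum_mul]
    _ = ∑ m ∈ Finset.Icc 1 ⌊2 * D⌋₊,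
          ∑ d ∈ Finset.Ioc ⌊D⌋₊ ⌊2 * D⌋₊ with m ∣ d, g m * F d := by
        refine Finset.sum_comm' fun d m => ?_
        simp only [Finset.mem_Ioc, Finset.mem_filter, Finset.mem_Icc, Nat.mem_divisors]
        constructor
        · rintro ⟨⟨h1, h2⟩, h3, h4⟩
          exact ⟨⟨⟨h1, h2⟩, h3⟩, Nat.pos_of_dvd_of_pos h3 (by omega),
            (Nat.le_of_dvd (by omega) h3).trans h2⟩
        · rintro ⟨⟨⟨h1, h2⟩, h3⟩, -, -⟩
          exact ⟨⟨h1, h2⟩, h3, by omega⟩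
    _ = _ := by
        refine Finset.sum_congr rfl fun m hm => ?_
        rw [← Finset.mul_sum, sum_Ioc_filter_dvd hD (Finset.mem_Icc.1 hm).1]

lemma blockTerm_le {κ lam x D m : ℝ} (hκ₀ : 0 < κ) (hκlam : κ ≤ lam) (hx : 0 < x)
    (hD : 0 < D) (hDY : D ≤ x ^ (1 / (1 + lam))) (hm : 0 < m) :
    blockTerm κ lam x D m ≤ x ^ (lam / (1 + lam)) * m ^ (-(lam / (1 + κ))) := by
  have h1 : D ^ ((lam - κ) / (1 + κ)) ≤ (x ^ (1 / (1 + lam))) ^ ((lam - κ) / (1 + κ)) :=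
    Real.rpow_le_rpow hD.le hDY (div_nonneg (by linarith) (by linarith))
  have h2 : x ^ (κ / (1 + κ)) * (x ^ (1 / (1 + lam))) ^ ((lam - κ) / (1 + κ)) =
      x ^ (lam / (1 + lam)) := by
    rw [← Real.rpow_mul hx.le, ← Real.rpow_add hx]
    congr 1
    have : 1 + lam ≠ 0 := by linarith
    field_simp
    ring
  rw [← h2]
  unfold blockTerm
  gcongr

lemma sq_div_mul_le {κ lam x D m : ℝ} (hκ₀ : 0 < κ) (hlam : 1 / 2 ≤ lam) (hlam₁ : lam < 1)
    (hx : 1 ≤ x) (hD : 0 < D) (hDY : D ≤ x ^ (1 / (1 + lam))) (hm : 1 ≤ m) :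
    D ^ 2 / (m * x) ≤ x ^ (lam / (1 + lam)) * m ^ (-(lam / (1 + κ))) := by
  have hx0 : 0 < x := by linarith
  have hm0 : 0 < m := by linarith
  have h1 : D ^ 2 / x ≤ x ^ (lam / (1 + lam)) := by
    rw [div_le_iff₀ hx0]
    calc D ^ 2 ≤ (x ^ (1 / (1 + lam))) ^ 2 := by gcongr
      _ = x ^ (2 / (1 + lam)) := by
          rw [← Real.rpow_natCast, ← Real.rpow_mul hx0.le]
          congr 1
          push_cast
          ring
      _ ≤ x ^ (lam / (1 + lam) + 1) := by
          refine Real.rpow_le_rpow_of_exponent_le hx ?_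
          rw [div_add_one (by linarith)]
          exact div_le_div_of_nonneg_right (by linarith) (by linarith)
      _ = x ^ (lam / (1 + lam)) * x := by rw [Real.rpow_add hx0, Real.rpow_one]
  have h2 : m⁻¹ ≤ m ^ (-(lam / (1 + κ))) := by
    rw [← Real.rpow_neg_one]
    refine Real.rpow_le_rpow_of_exponent_le hm ?_
    have : lam / (1 + κ) ≤ 1 := by
      rw [div_le_one (by linarith)]
      linarith
    linarith
  calc D ^ 2 / (m * x) = D ^ 2 / x * m⁻¹ := by field_simp
    _ ≤ _ := by gcongr

lemma exists_sum_mul_sawtooth_bound {δ κ lam A η : ℝ} (hκ₀ : 0 < κ) (hκ : κ ≤ 1 / 2)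
    (hlam : 1 / 2 ≤ lam) (hlam₁ : lam < 1) (hA : ExpSumHyp δ κ lam A)
    (hη : 0 < η) (hκη : κ + η ≤ 1) {f g : ℕ → ℝ}
    (hg : ∃ Cg : ℝ, 0 < Cg ∧ ∀ x : ℝ, 1 ≤ x →
      ∑ n ∈ Finset.Icc 1 ⌊x⌋₊, |g n| ≤ Cg * x ^ (lam / (1 + κ)))
    (hfg : ∀ n : ℕ, 0 < n → f n = ∑ d ∈ n.divisors, g d) :
    ∃ C : ℝ, 0 < C ∧ ∀ x : ℝ, 1 ≤ x → ∀ J : ℕ, x < 2 ^ J →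
      |∑ d ∈ Finset.Icc 1 ⌊x ^ (1 / (1 + lam))⌋₊, f d * sawtooth (x / (d + δ))| ≤
        C * ((J : ℝ) ^ 2 * x ^ (lam / (1 + lam) + η)) := by
  obtain ⟨Cg, hCg, hg⟩ := hg
  obtain ⟨C, hC, hblock⟩ :=
    exists_sawtooth_block_bound hκ₀ (hκ.trans hlam) hlam₁ hA hη hκη
  refine ⟨2 * C * (Cg * 2 ^ (lam / (1 + κ))), by positivity, fun x hx J hJ => ?_⟩
  have hx0 : 0 < x := by linarith
  have hYx : x ^ (1 / (1 + lam)) ≤ x := by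
    calc x ^ (1 / (1 + lam)) ≤ x ^ (1 : ℝ) := by
          refine Real.rpow_le_rpow_of_exponent_le hx ?_
          rw [div_le_one (by linarith)]
          linarith
      _ = x := Real.rpow_one x
  have hY0 : 0 < x ^ (1 / (1 + lam)) := by positivity
  have main : ∀ D : ℝ, 0 < D → 2 * D ≤ x ^ (1 / (1 + lam)) →
      |∑ d ∈ Finset.Ioc ⌊D⌋₊ ⌊2 * D⌋₊, f d * sawtooth (x / (d + δ))| ≤
        2 * C * x ^ (lam / (1 + lam) + η) * (J * (Cg * 2 ^ (lam / (1 + κ)))) := by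
    intro D hD hDY
    have hxη : 1 ≤ x ^ η := Real.one_le_rpow hx hη.le
    rw [sum_Ioc_divisor_sum_mul hfg hD.le (fun d => sawtooth (x / (d + δ)))]
    refine (Finset.abs_sum_le_sum_abs _ _).trans ?_
    calc ∑ m ∈ Finset.Icc 1 ⌊2 * D⌋₊, |g m * ∑ n ∈ Finset.Ioc ⌊D / m⌋₊ ⌊2 * (D / m)⌋₊,
          sawtooth (x / ((m * n : ℕ) + δ))|
        ≤ ∑ m ∈ Finset.Icc 1 ⌊2 * D⌋₊, 2 * C * x ^ (lam / (1 + lam) + η) *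
            (|g m| * (m : ℝ) ^ (-(lam / (1 + κ)))) := by
          refine Finset.sum_le_sum fun m hm => ?_
          obtain ⟨hm1, hm2⟩ := Finset.mem_Icc.1 hm
          have hm1' : (1 : ℝ) ≤ m := by exact_mod_cast hm1
          have hm2' : (m : ℝ) ≤ 2 * D := (Nat.le_floor_iff (by positivity)).1 hm2
          have hb := hblock x D hx hD (by linarith) m hm1 hm2'
          have h1 := blockTerm_le (D := D) (m := m) hκ₀ (hκ.trans hlam) hx0 hD
            (by linarith) (by linarith)
          have h2 := sq_div_mul_le hκ₀ hlam hlam₁ hx hD (by linarith) hm1'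
          rw [abs_mul]
          push_cast
          set W := x ^ (lam / (1 + lam)) * (m : ℝ) ^ (-(lam / (1 + κ))) with hW
          have hW0 : 0 ≤ W := by positivity
          calc |g m| * |∑ n ∈ Finset.Ioc ⌊D / m⌋₊ ⌊2 * (D / m)⌋₊, sawtooth (x / (m * n + δ))|
              ≤ |g m| * (C * (x ^ η * W + x ^ η * W)) := by
                refine mul_le_mul_of_nonneg_left (hb.trans ?_) (abs_nonneg _)
                have h3 : W ≤ x ^ η * W := le_mul_of_one_le_left hW0 hxη
                have h4 := h2.trans h3
                gcongr
            _ = _ := by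
                rw [hW, Real.rpow_add hx0]
                ring
      _ = 2 * C * x ^ (lam / (1 + lam) + η) *
            ∑ m ∈ Finset.Icc 1 ⌊2 * D⌋₊, |g m| * (m : ℝ) ^ (-(lam / (1 + κ))) := by
          rw [Finset.mul_sum]
      _ ≤ _ := by
          refine mul_le_mul_of_nonneg_left ?_ (by positivity)
          exact sum_abs_mul_rpow_neg_le hCg.le (by positivity) hg J (by linarith) (by linarith)
  refine (abs_sum_Icc_le_of_dyadic _ main J _ hY0 le_rfl (by linarith)).trans (le_of_eq ?_)
  ring

lemma natFloor_eq_sub_sawtooth {t : ℝ} (ht : 0 ≤ t) :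
    (⌊t⌋₊ : ℝ) = t - 1 / 2 - sawtooth t := by
  rw [natCast_floor_eq_intCast_floor ht]
  unfold sawtooth
  linarith [Int.floor_add_fract t]

lemma card_filter_floor_div_eq {x : ℝ} (hx : 0 ≤ x) {d : ℕ} (hd : 0 < d) :
    ((((Finset.Icc 1 ⌊x⌋₊).filter (fun n : ℕ => ⌊x / (n : ℝ)⌋₊ = d)).card : ℕ) : ℝ) =
      x / (d * (d + 1)) - sawtooth (x / (d + 0)) + sawtooth (x / (d + 1)) := by
  have hd0 : (0 : ℝ) < d := by exact_mod_cast hd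
  have e : (Finset.Icc 1 ⌊x⌋₊).filter (fun n : ℕ => ⌊x / (n : ℝ)⌋₊ = d) =
      Finset.Ioc ⌊x / ((d : ℝ) + 1)⌋₊ ⌊x / (d : ℝ)⌋₊ := by
    ext n
    rw [Finset.mem_filter, Finset.mem_Icc, Finset.mem_Ioc, Nat.floor_eq_iff (by positivity),
      Nat.le_floor_iff hx, Nat.le_floor_iff (by positivity), Nat.floor_lt (by positivity),
      div_lt_iff₀ (show (0 : ℝ) < d + 1 by positivity), le_div_iff₀ hd0]
    constructor
    · rintro ⟨⟨h1, -⟩, h3, h4⟩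
      have hn : (0 : ℝ) < n := by exact_mod_cast h1
      rw [le_div_iff₀ hn] at h3
      rw [div_lt_iff₀ hn] at h4
      constructor <;> linarith
    · rintro ⟨h3, h4⟩
      have hn : (0 : ℝ) < n := by
        by_contra! hn
        have : (n : ℝ) * (d + 1) ≤ 0 := mul_nonpos_of_nonpos_of_nonneg hn (by positivity)
        linarith
      have hd1 : (1 : ℝ) ≤ d := by exact_mod_cast hd
      rw [le_div_iff₀ hn, div_lt_iff₀ hn]
      exact ⟨⟨by exact_mod_cast hn, by nlinarith⟩, by linarith, by linarith⟩
  have hle : ⌊x / ((d : ℝ) + 1)⌋₊ ≤ ⌊x / (d : ℝ)⌋₊ :=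
    Nat.floor_le_floor (div_le_div_of_nonneg_left hx hd0 (by linarith))
  rw [e, Nat.card_Ioc, Nat.cast_sub hle, natFloor_eq_sub_sawtooth (by positivity),
    natFloor_eq_sub_sawtooth (by positivity), add_zero]
  field_simp
  ring

lemma sum_filter_floor_div_le {x : ℝ} (hx : 0 ≤ x) (f : ℕ → ℝ) (L : ℕ) :
    ∑ n ∈ (Finset.Icc 1 ⌊x⌋₊).filter (fun n : ℕ => ⌊x / (n : ℝ)⌋₊ ≤ L), f ⌊x / (n : ℝ)⌋₊ =
      x * ∑ d ∈ Finset.Icc 1 L, f d / (d * (d + 1)) -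
        ∑ d ∈ Finset.Icc 1 L, f d * sawtooth (x / (d + 0)) +
        ∑ d ∈ Finset.Icc 1 L, f d * sawtooth (x / (d + 1)) := by
  rw [← Finset.sum_fiberwise_of_maps_to (t := Finset.Icc 1 L) (g := fun n : ℕ => ⌊x / (n : ℝ)⌋₊),
    Finset.mul_sum, ← Finset.sum_sub_distrib, ← Finset.sum_add_distrib]
  · refine Finset.sum_congr rfl fun d hd => ?_
    obtain ⟨hd1, hdL⟩ := Finset.mem_Icc.1 hd
    have e : ((Finset.Icc 1 ⌊x⌋₊).filter (fun n : ℕ => ⌊x / (n : ℝ)⌋₊ ≤ L)).filter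
        (fun n : ℕ => ⌊x / (n : ℝ)⌋₊ = d) =
        (Finset.Icc 1 ⌊x⌋₊).filter (fun n : ℕ => ⌊x / (n : ℝ)⌋₊ = d) := by
      ext n
      simp only [Finset.mem_filter]
      constructor
      · rintro ⟨⟨h1, -⟩, h3⟩
        exact ⟨h1, h3⟩
      · rintro ⟨h1, h3⟩
        exact ⟨⟨h1, h3 ▸ hdL⟩, h3⟩
    rw [e, Finset.sum_congr rfl fun n hn => by rw [(Finset.mem_filter.1 hn).2],
      Finset.sum_const, nsmul_eq_mul, card_filter_floor_div_eq hx hd1]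
    ring
  · intro n hn
    obtain ⟨h1, h2⟩ := Finset.mem_filter.1 hn
    obtain ⟨h3, h4⟩ := Finset.mem_Icc.1 h1
    refine Finset.mem_Icc.2 ⟨?_, h2⟩
    have hn0 : (0 : ℝ) < n := by exact_mod_cast h3
    rw [Nat.one_le_floor_iff, one_le_div hn0]
    exact (Nat.le_floor_iff hx).1 h4

lemma sum_filter_lt_floor_div_le {x Y ε C : ℝ} (hx : 0 ≤ x) (hY : 0 < Y) (hε : 0 ≤ ε)
    (hC : 0 ≤ C) {f : ℕ → ℝ} (hf : ∀ n : ℕ, 0 < n → f n ≤ C * (n : ℝ) ^ ε) :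
    ∑ n ∈ (Finset.Icc 1 ⌊x⌋₊).filter (fun n : ℕ => ¬ ⌊x / (n : ℝ)⌋₊ ≤ ⌊Y⌋₊), f ⌊x / (n : ℝ)⌋₊ ≤
      x / Y * (C * x ^ ε) := by
  have hterm : ∀ n ∈ (Finset.Icc 1 ⌊x⌋₊).filter (fun n : ℕ => ¬ ⌊x / (n : ℝ)⌋₊ ≤ ⌊Y⌋₊),
      f ⌊x / (n : ℝ)⌋₊ ≤ C * x ^ ε := by
    intro n hn
    obtain ⟨h1, h2⟩ := Finset.mem_filter.1 hn
    refine (hf _ (by omega)).trans ?_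
    have : (⌊x / (n : ℝ)⌋₊ : ℝ) ≤ x :=
      (Nat.floor_le (by positivity)).trans
        (div_le_self hx (by exact_mod_cast (Finset.mem_Icc.1 h1).1))
    gcongr
  refine (Finset.sum_le_card_nsmul _ _ _ hterm).trans ?_
  rw [nsmul_eq_mul]
  refine mul_le_mul_of_nonneg_right ?_ (by positivity)
  have hsub : (Finset.Icc 1 ⌊x⌋₊).filter (fun n : ℕ => ¬ ⌊x / (n : ℝ)⌋₊ ≤ ⌊Y⌋₊) ⊆
      Finset.Icc 1 ⌊x / Y⌋₊ := by
    intro n hn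
    obtain ⟨h1, h2⟩ := Finset.mem_filter.1 hn
    have h3 := (Finset.mem_Icc.1 h1).1
    have hn0 : (0 : ℝ) < n := by exact_mod_cast h3
    refine Finset.mem_Icc.2 ⟨h3, (Nat.le_floor_iff (by positivity)).2 ?_⟩
    have h4 : Y < x / n := by
      by_contra! h
      exact h2 (Nat.floor_le_floor h)
    rw [lt_div_iff₀ hn0] at h4
    rw [le_div_iff₀ hY]
    linarith
  calc ((((Finset.Icc 1 ⌊x⌋₊).filter (fun n : ℕ => ¬ ⌊x / (n : ℝ)⌋₊ ≤ ⌊Y⌋₊)).card : ℕ) : ℝ)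
      ≤ ((Finset.Icc 1 ⌊x / Y⌋₊).card : ℝ) := by exact_mod_cast Finset.card_le_card hsub
    _ = (⌊x / Y⌋₊ : ℝ) := by simp
    _ ≤ x / Y := Nat.floor_le (by positivity)

lemma summable_succ_rpow_neg {p : ℝ} (hp : 1 < p) :
    Summable fun n : ℕ => ((n : ℝ) + 1) ^ (-p) := by
  have := (summable_nat_add_iff 1).2 (Real.summable_nat_rpow.2 (neg_lt_neg hp))
  simpa using this

lemma div_succ_mul_le_rpow {ε C : ℝ} (hC : 0 ≤ C) {f : ℕ → ℝ}
    (hf : ∀ n : ℕ, 0 < n → f n ≤ C * (n : ℝ) ^ (ε / 2)) (n : ℕ) :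
    f (n + 1) / (((n : ℝ) + 1) * ((n : ℝ) + 2)) ≤
      C * ((n : ℝ) + 1) ^ (ε - 1) * ((n : ℝ) + 1) ^ (-(1 + ε / 2)) := by
  have hn : (0 : ℝ) < (n : ℝ) + 1 := by positivity
  have h1 := hf (n + 1) n.succ_pos
  push_cast at h1
  have h2 : C * ((n : ℝ) + 1) ^ (ε - 1) * ((n : ℝ) + 1) ^ (-(1 + ε / 2)) =
      C * ((n : ℝ) + 1) ^ (ε / 2) / (((n : ℝ) + 1) * ((n : ℝ) + 1)) := by
    rw [mul_assoc, ← Real.rpow_add hn, show ε - 1 + -(1 + ε / 2) = ε / 2 - 2 by ring,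
      Real.rpow_sub hn, mul_div_assoc, Real.rpow_two, sq]
  rw [h2]
  gcongr
  linarith

lemma summable_div_succ_mul {ε C : ℝ} (hε : 0 < ε) (hε1 : ε < 1) (hC : 0 ≤ C) {f : ℕ → ℝ}
    (hfpos : ∀ n : ℕ, 0 < n → 0 < f n)
    (hf : ∀ n : ℕ, 0 < n → f n ≤ C * (n : ℝ) ^ (ε / 2)) :
    Summable fun n : ℕ => f (n + 1) / (((n : ℝ) + 1) * ((n : ℝ) + 2)) := by
  have hs := (summable_succ_rpow_neg (p := 1 + ε / 2) (by linarith)).mul_left C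
  refine Summable.of_nonneg_of_le (fun n => ?_) (fun n => ?_) hs
  · have := hfpos (n + 1) n.succ_pos
    positivity
  · refine (div_succ_mul_le_rpow hC hf n).trans ?_
    have : ((n : ℝ) + 1) ^ (ε - 1) ≤ 1 :=
      Real.rpow_le_one_of_one_le_of_nonpos (by linarith [(Nat.cast_nonneg n : (0 : ℝ) ≤ n)])
        (by linarith)
    have h2 : C * ((n : ℝ) + 1) ^ (ε - 1) ≤ C := mul_le_of_le_one_right hC this
    gcongr

lemma tsum_tail_div_succ_mul_le {ε C Y : ℝ} (hε : 0 < ε) (hε1 : ε < 1) (hC : 0 ≤ C) (hY : 0 < Y)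
    {f : ℕ → ℝ} (hfpos : ∀ n : ℕ, 0 < n → 0 < f n)
    (hf : ∀ n : ℕ, 0 < n → f n ≤ C * (n : ℝ) ^ (ε / 2)) :
    ∑' n : ℕ, f (n + ⌊Y⌋₊ + 1) / ((((n + ⌊Y⌋₊ : ℕ) : ℝ) + 1) * (((n + ⌊Y⌋₊ : ℕ) : ℝ) + 2)) ≤
      C * Y ^ (ε - 1) * ∑' n : ℕ, ((n : ℝ) + 1) ^ (-(1 + ε / 2)) := by
  rw [← tsum_mul_left]
  have hs := summable_succ_rpow_neg (p := 1 + ε / 2) (by linarith)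
  refine Summable.tsum_le_tsum (fun n => ?_)
    ((summable_nat_add_iff ⌊Y⌋₊).2 (summable_div_succ_mul hε hε1 hC hfpos hf)) (hs.mul_left _)
  refine (div_succ_mul_le_rpow hC hf (n + ⌊Y⌋₊)).trans ?_
  have hn : (0 : ℝ) ≤ n := Nat.cast_nonneg n
  have h1 : Y ≤ ((n + ⌊Y⌋₊ : ℕ) : ℝ) + 1 := by
    push_cast
    linarith [Nat.lt_floor_add_one Y]
  have h2 : (((n + ⌊Y⌋₊ : ℕ) : ℝ) + 1) ^ (ε - 1) ≤ Y ^ (ε - 1) :=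
    Real.rpow_le_rpow_of_nonpos hY h1 (by linarith)
  have h3 : (((n + ⌊Y⌋₊ : ℕ) : ℝ) + 1) ^ (-(1 + ε / 2)) ≤ ((n : ℝ) + 1) ^ (-(1 + ε / 2)) := by
    refine Real.rpow_le_rpow_of_nonpos (by positivity) ?_ (by linarith)
    push_cast
    linarith [(Nat.cast_nonneg ⌊Y⌋₊ : (0 : ℝ) ≤ ⌊Y⌋₊)]
  gcongr

lemma exists_lt_two_pow_le_rpow {c x : ℝ} (hc : 0 < c) (hx : 1 ≤ x) :
    ∃ J : ℕ, x < 2 ^ J ∧ (J : ℝ) ≤ (2 / c + 1) * x ^ c := by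
  refine ⟨Nat.log 2 ⌊x⌋₊ + 1, ?_, ?_⟩
  · have h := Nat.lt_pow_succ_log_self one_lt_two ⌊x⌋₊
    have h2 : ⌊x⌋₊ + 1 ≤ 2 ^ (Nat.log 2 ⌊x⌋₊ + 1) := h
    refine (Nat.lt_floor_add_one x).trans_le ?_
    exact_mod_cast h2
  · have hfl : 1 ≤ ⌊x⌋₊ := (Nat.one_le_floor_iff x).2 hx
    have h1 : 2 ^ Nat.log 2 ⌊x⌋₊ ≤ ⌊x⌋₊ := Nat.pow_log_le_self 2 (by omega)
    have h2 : (2 : ℝ) ^ Nat.log 2 ⌊x⌋₊ ≤ x :=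
      le_trans (by exact_mod_cast h1) (Nat.floor_le (by linarith))
    have h3 := Real.log_le_log (by positivity) h2
    rw [Real.log_pow] at h3
    have h4 := Real.log_le_rpow_div (by linarith : 0 ≤ x) hc
    have h5 : (1 : ℝ) / 2 ≤ Real.log 2 := by linarith [Real.log_two_gt_d9]
    have h6 : 1 ≤ x ^ c := Real.one_le_rpow hx hc.le
    have h7 : (Nat.log 2 ⌊x⌋₊ : ℝ) * (1 / 2) ≤ Nat.log 2 ⌊x⌋₊ * Real.log 2 := by gcongr
    push_cast
    have h8 : (2 / c + 1) * x ^ c = 2 * (x ^ c / c) + x ^ c := by ring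
    linarith

lemma isBigO_of_lt_one {κ lam : ℝ} (hκ₀ : 0 < κ) (hκ : κ ≤ 1 / 2) (hlam : 1 / 2 ≤ lam)
    (hlam₁ : lam < 1) {A₀ A₁ : ℝ} (hA₀ : ExpSumHyp 0 κ lam A₀) (hA₁ : ExpSumHyp 1 κ lam A₁)
    {f g : ℕ → ℝ}
    (hg : ∃ Cg : ℝ, 0 < Cg ∧ ∀ x : ℝ, 1 ≤ x →
      ∑ n ∈ Finset.Icc 1 ⌊x⌋₊, |g n| ≤ Cg * x ^ (lam / (1 + κ)))
    (hfg : ∀ n : ℕ, 0 < n → f n = ∑ d ∈ n.divisors, g d)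
    (hfpos : ∀ n : ℕ, 0 < n → 0 < f n)
    (hfsub : ∀ ε : ℝ, 0 < ε → ∃ Cε : ℝ, 0 < Cε ∧ ∀ n : ℕ, 0 < n → f n ≤ Cε * (n : ℝ) ^ ε)
    {ε : ℝ} (hε : 0 < ε) (hε1 : ε < 1) :
    (fun x : ℝ => (∑ n ∈ Finset.Icc 1 ⌊x⌋₊, f ⌊x / (n : ℝ)⌋₊) -
        (∑' n : ℕ, f (n + 1) / (((n : ℝ) + 1) * ((n : ℝ) + 2))) * x)
      =O[atTop] fun x : ℝ => x ^ (lam / (1 + lam) + ε) := by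
  obtain ⟨C₀, hC₀, hU₀⟩ := exists_sum_mul_sawtooth_bound (η := ε / 2) hκ₀ hκ hlam hlam₁ hA₀
    (by linarith) (by linarith) hg hfg
  obtain ⟨C₁, hC₁, hU₁⟩ := exists_sum_mul_sawtooth_bound (η := ε / 2) hκ₀ hκ hlam hlam₁ hA₁
    (by linarith) (by linarith) hg hfg
  obtain ⟨C₂, hC₂, hf₂⟩ := hfsub ε hε
  obtain ⟨C₃, hC₃, hf₃⟩ := hfsub (ε / 2) (by linarith)
  set Z := ∑' n : ℕ, ((n : ℝ) + 1) ^ (-(1 + ε / 2))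
  have hZ : 0 ≤ Z := tsum_nonneg fun n => by positivity
  refine IsBigO.of_bound ((C₀ + C₁) * (2 / (ε / 4) + 1) ^ 2 + C₂ + C₃ * Z) ?_
  filter_upwards [eventually_ge_atTop 1] with x hx
  have hx0 : 0 < x := by linarith
  have hl : 0 < 1 + lam := by linarith
  obtain ⟨J, hJ, hJ'⟩ := exists_lt_two_pow_le_rpow (c := ε / 4) (by linarith) hx
  have hU₀ := hU₀ x hx J hJ
  have hU₁ := hU₁ x hx J hJ
  set E := x ^ (lam / (1 + lam) + ε) with hE
  have hE0 : 0 < E := by positivity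
  have hJE : (J : ℝ) ^ 2 * x ^ (lam / (1 + lam) + ε / 2) ≤ (2 / (ε / 4) + 1) ^ 2 * E := by
    calc (J : ℝ) ^ 2 * x ^ (lam / (1 + lam) + ε / 2)
        ≤ ((2 / (ε / 4) + 1) * x ^ (ε / 4)) ^ 2 * x ^ (lam / (1 + lam) + ε / 2) := by gcongr
      _ = (2 / (ε / 4) + 1) ^ 2 * (x ^ (ε / 4) * x ^ (ε / 4) * x ^ (lam / (1 + lam) + ε / 2)) := by
          ring
      _ = (2 / (ε / 4) + 1) ^ 2 * E := by
          rw [← Real.rpow_add hx0, ← Real.rpow_add hx0, hE]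
          congr 2
          ring
  set Y := x ^ (1 / (1 + lam)) with hY
  have hY0 : 0 < Y := by positivity
  have hxY : x / Y = x ^ (lam / (1 + lam)) := by
    rw [hY, div_eq_iff (by positivity), ← Real.rpow_add hx0, ← add_div, add_comm lam,
      div_self hl.ne', Real.rpow_one]
  have hR := sum_filter_lt_floor_div_le hx0.le hY0 hε.le hC₂.le hf₂
  rw [hxY] at hR
  have hR' : x ^ (lam / (1 + lam)) * (C₂ * x ^ ε) = C₂ * E := by
    rw [hE, Real.rpow_add hx0]
    ring
  have hR0 : 0 ≤ ∑ n ∈ (Finset.Icc 1 ⌊x⌋₊).filter (fun n : ℕ => ¬ ⌊x / (n : ℝ)⌋₊ ≤ ⌊Y⌋₊),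
      f ⌊x / (n : ℝ)⌋₊ := by
    refine Finset.sum_nonneg fun n hn => (hfpos _ ?_).le
    have := (Finset.mem_filter.1 hn).2
    omega
  have hsum := summable_div_succ_mul hε hε1 hC₃.le hfpos hf₃
  have hsplit := hsum.sum_add_tsum_nat_add ⌊Y⌋₊
  have htail := tsum_tail_div_succ_mul_le hε hε1 hC₃.le hY0 hfpos hf₃
  have htail0 : 0 ≤ ∑' n : ℕ, f (n + ⌊Y⌋₊ + 1) /
      ((((n + ⌊Y⌋₊ : ℕ) : ℝ) + 1) * (((n + ⌊Y⌋₊ : ℕ) : ℝ) + 2)) :=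
    tsum_nonneg fun n => by
      have := hfpos (n + ⌊Y⌋₊ + 1) (Nat.succ_pos _)
      positivity
  have hrange : ∑ d ∈ Finset.Icc 1 ⌊Y⌋₊, f d / (d * (d + 1)) =
      ∑ n ∈ Finset.range ⌊Y⌋₊, f (n + 1) / (((n : ℝ) + 1) * ((n : ℝ) + 2)) := by
    rw [← Finset.Ico_add_one_right_eq_Icc, Finset.sum_Ico_eq_sum_range, Nat.add_sub_cancel]
    refine Finset.sum_congr rfl fun n _ => ?_
    rw [add_comm 1 n]
    push_cast
    congr 2
    ring
  have hmain := sum_filter_floor_div_le hx0.le f ⌊Y⌋₊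
  have hall := Finset.sum_filter_add_sum_filter_not (Finset.Icc 1 ⌊x⌋₊)
    (fun n : ℕ => ⌊x / (n : ℝ)⌋₊ ≤ ⌊Y⌋₊) (fun n => f ⌊x / (n : ℝ)⌋₊)
  rw [hrange] at hmain
  have hxT : x * Y ^ (ε - 1) ≤ E := by
    calc x * Y ^ (ε - 1) = x / Y * Y ^ ε := by
          rw [Real.rpow_sub hY0, Real.rpow_one]
          ring
      _ ≤ x ^ (lam / (1 + lam)) * x ^ ε := by
          rw [hxY]
          have : Y ≤ x := by
            rw [hY]
            refine (Real.rpow_le_rpow_of_exponent_le hx ?_).trans_eq (Real.rpow_one x)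
            rw [div_le_one hl]
            linarith
          gcongr
      _ = E := by rw [hE, Real.rpow_add hx0]
  rw [← hsplit, ← hall, hmain, Real.norm_eq_abs, Real.norm_eq_abs, abs_of_pos hE0]
  set T := ∑' n : ℕ, f (n + ⌊Y⌋₊ + 1) /
      ((((n + ⌊Y⌋₊ : ℕ) : ℝ) + 1) * (((n + ⌊Y⌋₊ : ℕ) : ℝ) + 2))
  have hTx : x * T ≤ C₃ * Z * E := by
    calc x * T ≤ x * (C₃ * Y ^ (ε - 1) * Z) := by gcongr
      _ = C₃ * Z * (x * Y ^ (ε - 1)) := by ring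
      _ ≤ C₃ * Z * E := by gcongr
  have hTx0 : 0 ≤ x * T := by positivity
  have hC₀E := hU₀.trans (mul_le_mul_of_nonneg_left hJE hC₀.le)
  have hC₁E := hU₁.trans (mul_le_mul_of_nonneg_left hJE hC₁.le)
  have hC₂E : 0 ≤ C₂ * E := by positivity
  have hC₃E : 0 ≤ C₃ * Z * E := by positivity
  rw [abs_le] at hC₀E hC₁E
  rw [abs_le]
  constructor <;> linarith

/-- If `(κ,λ)` satisfies the exponential-sum hypothesis for `δ = 0` and
`δ = 1`, `∑_{n ≤ x} |g(n)| = O(x^{λ/(1+κ)})`, and `f(n) = ∑_{d∣n} g(d)` is a positive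
real-valued arithmetic function with `f(n) = O_ε(n^ε)` for every `ε > 0`, then for every
`ε > 0`, `S_f(x) = ∑_{n ≤ x} f(⌊x/n⌋) = C_f x + O_ε(x^{λ/(1+λ)+ε})` as `x → ∞`, where
`C_f = ∑_{n=1}^∞ f(n)/(n(n+1))`. -/
theorem S_f_asymptotic_subpolynomial (κ lam : ℝ)
    (hκ₀ : 0 < κ) (hκ : κ ≤ 1 / 2) (hlam : 1 / 2 ≤ lam) (hlam₁ : lam < 1)
    (A₀ : ℝ) (hA₀ : ExpSumHyp 0 κ lam A₀)
    (A₁ : ℝ) (hA₁ : ExpSumHyp 1 κ lam A₁)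
    (g : ℕ → ℝ)
    (hg : ∃ Cg : ℝ, 0 < Cg ∧ ∀ x : ℝ, 1 ≤ x →
      ∑ n ∈ Finset.Icc 1 ⌊x⌋₊, |g n| ≤ Cg * x ^ (lam / (1 + κ)))
    (f : ℕ → ℝ)
    (hfg : ∀ n : ℕ, 0 < n → f n = ∑ d ∈ n.divisors, g d)
    (hfpos : ∀ n : ℕ, 0 < n → 0 < f n)
    (hfsub : ∀ ε : ℝ, 0 < ε → ∃ Cε : ℝ, 0 < Cε ∧ ∀ n : ℕ, 0 < n → f n ≤ Cε * (n : ℝ) ^ ε) :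
    ∀ ε : ℝ, 0 < ε →
      (fun x : ℝ => (∑ n ∈ Finset.Icc 1 ⌊x⌋₊, f ⌊x / (n : ℝ)⌋₊) -
          (∑' n : ℕ, f (n + 1) / (((n : ℝ) + 1) * ((n : ℝ) + 2))) * x)
        =O[atTop] fun x : ℝ => x ^ (lam / (1 + lam) + ε) := by
  intro ε hε
  rcases lt_or_ge ε 1 with hε1 | hε1
  · exact isBigO_of_lt_one hκ₀ hκ hlam hlam₁ hA₀ hA₁ hg hfg hfpos hfsub hε hε1
  · refine (isBigO_of_lt_one hκ₀ hκ hlam hlam₁ hA₀ hA₁ hg hfg hfpos hfsub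
      one_half_pos one_half_lt_one).trans (IsBigO.of_bound 1 ?_)
    filter_upwards [eventually_ge_atTop 1] with x hx
    rw [one_mul, Real.norm_of_nonneg (by positivity), Real.norm_of_nonneg (by positivity)]
    exact Real.rpow_le_rpow_of_exponent_le hx (by linarith)
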